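/- (Submodularity of transcendence degree) Let K ⊆ L be a field extension and let S and T be finite subsets of L. Then trdeg_K K(S ∪ T) + trdeg_K K(S ∩ T) ≤ trdeg_K K(S) + trdeg_K K(T), where K(X) denotes the intermediate field generated by X over K. In particular, for elements y₁,…,yₙ ∈ L, the function assigning to each subset S ⊆ {1,…,n} the transcendence degree of K({y_i : i ∈ S}) over K is the rank function of a matroid (an algebraic matroid). -/

import Mathlib

/-- The transcendence degree over `K` of the intermediate field `K(S)` generated by a
subset `S` of `L`: the maximal number of elements of `K(S)` that are algebraically
independent over `K`. -/
noncomputable def trdegAdjoin (K : Type*) [Field K] {L : Type*} [Field L] [Algebra K L]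
    (S : Set L) : ℕ :=
  sSup {n : ℕ | ∃ t : Finset L, (t : Set L) ⊆ (IntermediateField.adjoin K S : Set L) ∧
    t.card = n ∧ AlgebraicIndependent K (fun x : t => (x : L))}

lemma trdegAdjoin_eq_eRk (K L : Type*) [Field K] [Field L] [Algebra K L]
    (S : Set L) (hS : S.Finite) :
    (trdegAdjoin K S : ℕ∞) = (AlgebraicIndependent.matroid K L).eRk S := by
  set M := AlgebraicIndependent.matroid K L with hM
  obtain ⟨I, hI⟩ := M.exists_isBasis S
  have hIfin : I.Finite := hS.subset hI.subset
  have hsub : (IntermediateField.adjoin K S : Set L) ⊆ M.closure S := by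
    rw [hM, AlgebraicIndependent.matroid_closure_eq]
    intro x hx
    obtain ⟨a, ha, b, hb, rfl⟩ := IntermediateField.mem_adjoin_iff_div.1 hx
    have key : ∀ c ∈ Algebra.adjoin K S, IsAlgebraic (Algebra.adjoin K S) c := fun c hc =>
      isAlgebraic_algebraMap (⟨c, hc⟩ : Algebra.adjoin K S)
    rw [div_eq_mul_inv]
    exact (key a ha).mul (key b hb).inv
  have hub : ∀ n ∈ {n : ℕ | ∃ t : Finset L,
      (t : Set L) ⊆ (IntermediateField.adjoin K S : Set L) ∧
      t.card = n ∧ AlgebraicIndependent K (fun x : t => (x : L))}, n ≤ I.ncard := by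
    rintro n ⟨t, ht, rfl, hind⟩
    have h1 : M.Indep (t : Set L) := AlgebraicIndependent.matroid_indep_iff.2 hind
    have h2 := M.eRk_mono (ht.trans hsub)
    rw [h1.eRk_eq_encard, M.eRk_closure_eq, hI.eRk_eq_encard, ← hIfin.cast_ncard_eq,
      Set.encard_coe_eq_coe_finsetCard] at h2
    exact_mod_cast h2
  rw [hI.eRk_eq_encard, ← hIfin.cast_ncard_eq]
  congr 1
  refine IsGreatest.csSup_eq ⟨⟨hIfin.toFinset, ?_, ?_, ?_⟩, hub⟩
  · rw [hIfin.coe_toFinset]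
    exact hI.subset.trans (IntermediateField.subset_adjoin K S)
  · exact (Set.ncard_eq_toFinset_card I hIfin).symm
  · have h1 : M.Indep (hIfin.toFinset : Set L) := by
      rw [hIfin.coe_toFinset]; exact hI.indep
    exact AlgebraicIndependent.matroid_indep_iff.1 h1

/-- Submodularity of transcendence degree: for finite subsets `S`, `T` of a field extension
`L` of `K`, `trdeg K(S ∪ T) + trdeg K(S ∩ T) ≤ trdeg K(S) + trdeg K(T)`.  In particular,
`S ↦ trdeg_K K(S)` is the rank function of a matroid (an algebraic matroid). -/
theorem trdeg_submodular (K L : Type*) [Field K] [Field L] [Algebra K L]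
    (S T : Set L) (hS : S.Finite) (hT : T.Finite) :
    trdegAdjoin K (S ∪ T) + trdegAdjoin K (S ∩ T) ≤
      trdegAdjoin K S + trdegAdjoin K T := by
  have h := (AlgebraicIndependent.matroid K L).eRk_submod S T
  rw [← trdegAdjoin_eq_eRk K L S hS, ← trdegAdjoin_eq_eRk K L T hT,
    ← trdegAdjoin_eq_eRk K L _ (hS.union hT),
    ← trdegAdjoin_eq_eRk K L _ (hS.inter_of_left T), add_comm] at h
  exact_mod_cast h
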